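/- arXiv:2310.09729 — 2 statements merged into one kernel-verified Lean document; each statement's English description precedes it below -/
import Mathlib

section
/- Basic composition rule: let M₁, …, M_k be mechanisms from datasets to probability measures on measurable spaces R₁, …, R_k, where each Mᵢ satisfies (εᵢ, δᵢ)-differential privacy. Then the composed mechanism M defined by M(D) = (M₁ D) ⊗ (M₂ D) ⊗ ⋯ ⊗ (M_k D) (the product measure of the k independent runs on the same dataset D, a probability measure on R₁ × ⋯ × R_k) satisfies (Σᵢ εᵢ, Σᵢ δᵢ)-differential privacy. -/
open MeasureTheory ProbabilityTheory

/-- Two datasets (finite multisets of records) are adjacent if one is obtained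
from the other by adding a single record. -/
def Adjacent {X : Type*} (D D' : Multiset X) : Prop :=
  (∃ x, D' = D + {x}) ∨ (∃ x, D = D' + {x})

/-- A mechanism `M` from datasets to probability measures on `R` satisfies
`(ε, δ)`-differential privacy if for all adjacent datasets `D, D'` and all
measurable `O ⊆ R`, `M D O ≤ e^ε * M D' O + δ`. -/
def IsDP {X R : Type*} [MeasurableSpace R]
    (M : Multiset X → Measure R) (ε δ : ℝ) : Prop :=
  ∀ D D' : Multiset X, Adjacent D D' → ∀ O : Set R, MeasurableSet O →
    M D O ≤ ENNReal.ofReal (Real.exp ε) * M D' O + ENNReal.ofReal δ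

open scoped ENNReal NNReal

/-- An `(c, d)`-domination between measures of sets extends to integrals of `[0, 1]`-valued
functions. -/
lemma lintegral_le_mul_add_of_le_one {A : Type*} [MeasurableSpace A] {P Q : Measure A}
    [IsFiniteMeasure P] [IsFiniteMeasure Q] {c : ℝ≥0} {d : ℝ≥0∞}
    (h : ∀ O, MeasurableSet O → P O ≤ c * Q O + d)
    {g : A → ℝ≥0∞} (hg : Measurable g) (hg_le : ∀ a, g a ≤ 1) :
    ∫⁻ a, g a ∂P ≤ c * ∫⁻ a, g a ∂Q + d := by
  obtain ⟨s, hs, hQP, hPQ⟩ := hahn_decomposition P (c • Q)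
  have hle : (c • Q).restrict s ≤ P.restrict s := Measure.le_iff.2 fun t ht => by
    rw [Measure.restrict_apply ht, Measure.restrict_apply ht]
    exact hQP _ (ht.inter hs) Set.inter_subset_right
  have hge : P.restrict sᶜ ≤ (c • Q).restrict sᶜ := Measure.le_iff.2 fun t ht => by
    rw [Measure.restrict_apply ht, Measure.restrict_apply ht]
    exact hPQ _ (ht.inter hs.compl) Set.inter_subset_right
  have hsplit (μ : Measure A) :
      ∫⁻ a in s, g a ∂μ + ∫⁻ a in s, (1 - g a) ∂μ = μ s := by
    rw [← lintegral_add_left hg]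
    simp [add_tsub_cancel_of_le (hg_le _)]
  have hfin : ∫⁻ a in s, (1 - g a) ∂(c • Q) ≠ ∞ :=
    ne_top_of_le_ne_top (measure_ne_top (c • Q) s) (le_add_self.trans_eq (hsplit _))
  have hon : ∫⁻ a in s, g a ∂P ≤ ∫⁻ a in s, g a ∂(c • Q) + d := by
    refine (ENNReal.add_le_add_iff_right hfin).1 ?_
    calc ∫⁻ a in s, g a ∂P + ∫⁻ a in s, (1 - g a) ∂(c • Q)
        ≤ ∫⁻ a in s, g a ∂P + ∫⁻ a in s, (1 - g a) ∂P := by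
          gcongr
      _ = P s := hsplit P
      _ ≤ (c • Q) s + d := h s hs
      _ = _ := by rw [← hsplit (c • Q)]; ring
  calc ∫⁻ a, g a ∂P = ∫⁻ a in s, g a ∂P + ∫⁻ a in sᶜ, g a ∂P :=
        (lintegral_add_compl g hs).symm
    _ ≤ (∫⁻ a in s, g a ∂(c • Q) + d) + ∫⁻ a in sᶜ, g a ∂(c • Q) :=
        add_le_add hon (lintegral_mono' hge le_rfl)
    _ = ∫⁻ a, g a ∂(c • Q) + d := by rw [← lintegral_add_compl (μ := c • Q) g hs]; ring
    _ = c * ∫⁻ a, g a ∂Q + d := by rw [lintegral_smul_measure]; rfl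

lemma prod_le_mul_add {A B : Type*} [MeasurableSpace A] [MeasurableSpace B]
    {P Q : Measure A} {P' Q' : Measure B} [IsProbabilityMeasure P] [IsFiniteMeasure Q]
    [IsProbabilityMeasure P'] [IsFiniteMeasure Q'] {c c' : ℝ≥0} {d d' : ℝ≥0∞}
    (h : ∀ O, MeasurableSet O → P O ≤ c * Q O + d)
    (h' : ∀ O, MeasurableSet O → P' O ≤ c' * Q' O + d')
    {O : Set (A × B)} (hO : MeasurableSet O) :
    (P.prod P') O ≤ (c * c' : ℝ≥0) * (Q.prod Q') O + (d + d') := by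
  have hmeas : Measurable fun a => Q' (Prod.mk a ⁻¹' O) := measurable_measure_prodMk_left hO
  have hg : Measurable fun a => min 1 (c' * Q' (Prod.mk a ⁻¹' O)) :=
    measurable_const.min (hmeas.const_mul _)
  calc (P.prod P') O = ∫⁻ a, P' (Prod.mk a ⁻¹' O) ∂P := Measure.prod_apply hO
    _ ≤ ∫⁻ a, (min 1 (c' * Q' (Prod.mk a ⁻¹' O)) + d') ∂P := by
        refine lintegral_mono fun a => ?_
        rw [← min_add_add_right]
        exact le_min (prob_le_one.trans le_self_add) (h' _ (measurable_prodMk_left hO))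
    _ = ∫⁻ a, min 1 (c' * Q' (Prod.mk a ⁻¹' O)) ∂P + d' := by
        rw [lintegral_add_left hg]; simp
    _ ≤ (c * ∫⁻ a, min 1 (c' * Q' (Prod.mk a ⁻¹' O)) ∂Q + d) + d' := by
        gcongr
        exact lintegral_le_mul_add_of_le_one h hg fun _ => min_le_left _ _
    _ ≤ (c * ∫⁻ a, c' * Q' (Prod.mk a ⁻¹' O) ∂Q + d) + d' := by
        gcongr
        exact min_le_right _ _
    _ = _ := by
        rw [lintegral_const_mul _ hmeas, ← Measure.prod_apply hO, ENNReal.coe_mul]; ring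

lemma pi_le_prod_mul_add_sum {k : ℕ} {R : Fin k → Type*} [∀ i, MeasurableSpace (R i)]
    (P Q : ∀ i, Measure (R i)) [∀ i, IsProbabilityMeasure (P i)]
    [∀ i, IsProbabilityMeasure (Q i)] (c : Fin k → ℝ≥0) (d : Fin k → ℝ≥0∞)
    (h : ∀ i O, MeasurableSet O → P i O ≤ c i * Q i O + d i)
    {O : Set (∀ i, R i)} (hO : MeasurableSet O) :
    Measure.pi P O ≤ (∏ i, c i : ℝ≥0) * Measure.pi Q O + ∑ i, d i := by
  induction k with
  | zero => simp [Measure.pi_of_empty P, Measure.pi_of_empty Q]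
  | succ k ih =>
    have hP := (measurePreserving_piFinSuccAbove P 0).symm
    have hQ := (measurePreserving_piFinSuccAbove Q 0).symm
    rw [← hP.measure_preimage hO.nullMeasurableSet, ← hQ.measure_preimage hO.nullMeasurableSet,
      Fin.prod_univ_succ, Fin.sum_univ_succ]
    exact prod_le_mul_add (h 0)
      (fun O' hO' => ih (fun i => P i.succ) (fun i => Q i.succ) (fun i => c i.succ)
        (fun i => d i.succ) (fun i => h i.succ) hO')
      (hP.measurable hO)

/-- Basic composition rule: if each mechanism `M i` is `(ε i, δ i)`-DP, then the
mechanism releasing the tuple of the outputs of the `k` mechanisms run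
independently on the same dataset (the product measure `(M 1 D) ⊗ ⋯ ⊗ (M k D)`)
is `(∑ i, ε i, ∑ i, δ i)`-DP. -/
theorem dp_composition {X : Type*} {k : ℕ} (R : Fin k → Type*)
    [∀ i, MeasurableSpace (R i)]
    (ε δ : Fin k → ℝ) (hε : ∀ i, 0 ≤ ε i) (hδ : ∀ i, 0 ≤ δ i)
    (M : ∀ i, Multiset X → Measure (R i))
    (hM : ∀ i D, IsProbabilityMeasure (M i D))
    (hDP : ∀ i, IsDP (M i) (ε i) (δ i)) :
    IsDP (fun D => Measure.pi (fun i => M i D)) (∑ i, ε i) (∑ i, δ i) := by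
  intro D D' hD O hO
  rw [Real.exp_sum, ENNReal.ofReal_sum_of_nonneg fun i _ => hδ i,
    ENNReal.ofReal, Real.toNNReal_prod_of_nonneg fun i _ => (Real.exp_pos (ε i)).le]
  exact pi_le_prod_mul_add_sum (fun i => M i D) (fun i => M i D')
    (fun i => (Real.exp (ε i)).toNNReal) (fun i => ENNReal.ofReal (δ i))
    (fun i => hDP i D D' hD) hO
end

section
/- Composition followed by post-processing: let M₁, …, M_k be mechanisms from datasets to probability measures on measurable spaces R₁, …, R_k, where each Mᵢ satisfies (εᵢ, δᵢ)-differential privacy, and let F be a Markov kernel from R₁ × ⋯ × R_k to a measurable space S. Then the mechanism D ↦ ((M₁ D) ⊗ ⋯ ⊗ (M_k D)).bind F, which runs the k mechanisms independently on D and applies the randomized map F to the tuple of outputs, satisfies (Σᵢ εᵢ, Σᵢ δᵢ)-differential privacy. -/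
open MeasureTheory ProbabilityTheory

/-- `μ` is approximately dominated by `ν`: `μ O ≤ c * ν O + d` for all measurable `O`. -/
def ApproxLE {R : Type*} [MeasurableSpace R] (μ ν : Measure R) (c d : ENNReal) : Prop :=
  ∀ O : Set R, MeasurableSet O → μ O ≤ c * ν O + d

namespace ApproxLE

open scoped ENNReal

variable {R S : Type*} [MeasurableSpace R] [MeasurableSpace S]

/-- Approximate domination on sets extends to integrals of functions bounded by `1`. -/
lemma lintegral_le {μ ν : Measure R} {c d : ℝ≥0∞} (h : ApproxLE μ ν c d)
    {f : R → ℝ≥0∞} (hf : Measurable f) (hf1 : ∀ x, f x ≤ 1) :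
    ∫⁻ x, f x ∂μ ≤ c * ∫⁻ x, f x ∂ν + d := by
  have layer (ρ : Measure R) :
      ∫⁻ x, f x ∂ρ = ∫⁻ t in Set.Ioc (0 : ℝ) 1, ρ {x | t < (f x).toReal} := by
    have hρ := lintegral_eq_lintegral_meas_lt ρ (f := fun x => (f x).toReal)
      (Filter.Eventually.of_forall fun _ => ENNReal.toReal_nonneg)
      hf.ennreal_toReal.aemeasurable
    simp only [ENNReal.ofReal_toReal ((hf1 _).trans_lt ENNReal.one_lt_top).ne] at hρ
    rw [hρ, ← Set.Ioc_union_Ioi_eq_Ioi zero_le_one,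
      lintegral_union measurableSet_Ioi (Set.Ioc_disjoint_Ioi le_rfl)]
    have tail : ∫⁻ t in Set.Ioi (1 : ℝ), ρ {x | t < (f x).toReal} = 0 := by
      rw [setLIntegral_congr_fun (g := fun _ => 0) measurableSet_Ioi, lintegral_zero]
      intro t ht
      have : {x | t < (f x).toReal} = ∅ := by
        ext x
        have : (f x).toReal ≤ 1 := ENNReal.toReal_le_of_le_ofReal zero_le_one (by simpa using hf1 x)
        simpa using this.trans (le_of_lt ht)
      simp [this]
    rw [tail, add_zero]
  have meas (ρ : Measure R) : Measurable fun t : ℝ => ρ {x | t < (f x).toReal} :=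
    Antitone.measurable fun s t hst => measure_mono fun x hx => lt_of_le_of_lt hst hx
  rw [layer μ, layer ν, ← lintegral_const_mul _ (meas ν)]
  calc ∫⁻ t in Set.Ioc (0 : ℝ) 1, μ {x | t < (f x).toReal}
      ≤ ∫⁻ t in Set.Ioc (0 : ℝ) 1, (c * ν {x | t < (f x).toReal} + d) :=
        lintegral_mono fun t => h _ (measurableSet_lt measurable_const hf.ennreal_toReal)
    _ = _ := by
        rw [lintegral_add_right _ measurable_const]
        simp

lemma bind {μ ν : Measure R} {c d : ℝ≥0∞} (h : ApproxLE μ ν c d)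
    (F : Kernel R S) [IsMarkovKernel F] : ApproxLE (μ.bind F) (ν.bind F) c d := by
  intro O hO
  rw [Measure.bind_apply hO F.aemeasurable, Measure.bind_apply hO F.aemeasurable]
  exact h.lintegral_le (F.measurable_coe hO) fun _ => prob_le_one

lemma map {μ ν : Measure R} {c d : ℝ≥0∞} (h : ApproxLE μ ν c d)
    {g : R → S} (hg : Measurable g) : ApproxLE (μ.map g) (ν.map g) c d := by
  intro O hO
  rw [Measure.map_apply hg hO, Measure.map_apply hg hO]
  exact h _ (hg hO)

lemma prod {μ ν : Measure R} {μ' ν' : Measure S} [IsProbabilityMeasure μ]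
    [IsProbabilityMeasure μ'] [SFinite ν'] {c d c' d' : ℝ≥0∞}
    (h : ApproxLE μ ν c d) (h' : ApproxLE μ' ν' c' d') :
    ApproxLE (μ.prod μ') (ν.prod ν') (c * c') (d + d') := by
  intro O hO
  have hν' := measurable_measure_prodMk_left (ν := ν') hO
  have hmin : Measurable fun x => min 1 (c' * ν' (Prod.mk x ⁻¹' O)) :=
    measurable_const.min (hν'.const_mul c')
  rw [Measure.prod_apply hO, Measure.prod_apply hO]
  -- truncating at `1` before integrating keeps the integrand in the range of `lintegral_le`
  calc ∫⁻ x, μ' (Prod.mk x ⁻¹' O) ∂μ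
      ≤ ∫⁻ x, (min 1 (c' * ν' (Prod.mk x ⁻¹' O)) + d') ∂μ := by
        refine lintegral_mono fun x => ?_
        rw [← min_add_add_right]
        exact le_min (prob_le_one.trans le_self_add) (h' _ (measurable_prodMk_left hO))
    _ = ∫⁻ x, min 1 (c' * ν' (Prod.mk x ⁻¹' O)) ∂μ + d' := by
        rw [lintegral_add_right _ measurable_const]
        simp
    _ ≤ c * ∫⁻ x, min 1 (c' * ν' (Prod.mk x ⁻¹' O)) ∂ν + d + d' := by
        gcongr
        exact h.lintegral_le hmin fun _ => min_le_left _ _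
    _ ≤ c * ∫⁻ x, c' * ν' (Prod.mk x ⁻¹' O) ∂ν + d + d' := by
        gcongr
        exact min_le_right _ _
    _ = c * c' * ∫⁻ x, ν' (Prod.mk x ⁻¹' O) ∂ν + (d + d') := by
        rw [lintegral_const_mul _ hν', mul_assoc, add_assoc]

lemma pi {k : ℕ} {R : Fin k → Type*} [∀ i, MeasurableSpace (R i)]
    {μ ν : ∀ i, Measure (R i)} [∀ i, IsProbabilityMeasure (μ i)]
    [∀ i, IsProbabilityMeasure (ν i)] {c d : Fin k → ℝ≥0∞}
    (h : ∀ i, ApproxLE (μ i) (ν i) (c i) (d i)) :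
    ApproxLE (Measure.pi μ) (Measure.pi ν) (∏ i, c i) (∑ i, d i) := by
  induction k with
  | zero =>
    intro O _
    simp [Subsingleton.elim μ ν]
  | succ n ih =>
    rw [← (measurePreserving_piFinSuccAbove μ 0).symm.map_eq,
      ← (measurePreserving_piFinSuccAbove ν 0).symm.map_eq, Fin.prod_univ_succ, Fin.sum_univ_succ]
    exact ((h 0).prod (ih fun i => h i.succ)).map (MeasurableEquiv.measurable _)

end ApproxLE

/-- Composition followed by post-processing: if each `M i` is `(ε i, δ i)`-DP
and `F` is a Markov kernel from `R 1 × ⋯ × R k` to `S`, then running the `k`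
mechanisms independently on `D` and applying `F` to the tuple of outputs is
`(∑ i, ε i, ∑ i, δ i)`-DP. -/
theorem dp_composition_post_processing {X : Type*} {k : ℕ} (R : Fin k → Type*)
    [∀ i, MeasurableSpace (R i)] {S : Type*} [MeasurableSpace S]
    (ε δ : Fin k → ℝ) (hε : ∀ i, 0 ≤ ε i) (hδ : ∀ i, 0 ≤ δ i)
    (M : ∀ i, Multiset X → Measure (R i))
    (hM : ∀ i D, IsProbabilityMeasure (M i D))
    (hDP : ∀ i, IsDP (M i) (ε i) (δ i))
    (F : Kernel (∀ i, R i) S) [IsMarkovKernel F] :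
    IsDP (fun D => (Measure.pi (fun i => M i D)).bind F) (∑ i, ε i) (∑ i, δ i) := by
  intro D D' hD
  rw [Real.exp_sum, ENNReal.ofReal_prod_of_nonneg fun i _ => (Real.exp_pos _).le,
    ENNReal.ofReal_sum_of_nonneg fun i _ => hδ i]
  exact (ApproxLE.pi fun i => hDP i D D' hD).bind F
end
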